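/- Let A be an artin algebra with id A = m+1, m ≥ 1, whose minimal injective coresolution 0 → A → I⁰ → ⋯ → I^{m+1} → 0 has I⁰, …, I^m of projective dimension at most one. Then every indecomposable injective A-module has projective dimension either at most 1 or exactly m+1; and an indecomposable injective I' is a summand of I^{m+1} if and only if pd I' = m+1. -/

import Mathlib

open CategoryTheory TensorProduct

universe u

/-- The `k`-th Ext group of the `A`-modules `X` and `Y`. -/
noncomputable def ExtGrp (A : Type u) [Ring A] (k : ℕ)
    (X Y : Type u) [AddCommGroup X] [Module A X] [AddCommGroup Y] [Module A Y] : Type u :=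
  ((Ext ℤ (ModuleCat.{u} A) k).obj (Opposite.op (ModuleCat.of A X))).obj (ModuleCat.of A Y)

noncomputable instance (A : Type u) [Ring A] (k : ℕ)
    (X Y : Type u) [AddCommGroup X] [Module A X] [AddCommGroup Y] [Module A Y] :
    AddCommGroup (ExtGrp A k X Y) := by
  unfold ExtGrp; infer_instance

/-- `Ext_A^k(X, Y) = 0`. -/
def ExtZero (A : Type u) [Ring A] (k : ℕ)
    (X Y : Type u) [AddCommGroup X] [Module A X] [AddCommGroup Y] [Module A Y] : Prop :=
  Subsingleton (ExtGrp A k X Y)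

/-- `pd X ≤ n`: `Ext^k(X, -)` vanishes for all `k > n`. -/
def ProjDimLE (A : Type u) [Ring A] (X : Type u) [AddCommGroup X] [Module A X] (n : ℕ) : Prop :=
  ∀ k : ℕ, n < k → ∀ Y : ModuleCat.{u} A, ExtZero A k X Y

/-- The projective dimension of `X`, the length of a shortest projective resolution,
as an element of `ℕ∞` (`⊤` if infinite). -/
noncomputable def projDim (A : Type u) [Ring A] (X : Type u) [AddCommGroup X] [Module A X] : ℕ∞ :=
  sInf ((fun n : ℕ => (n : ℕ∞)) '' {n : ℕ | ProjDimLE A X n})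

/-- `id Y ≤ n`: `Ext^k(-, Y)` vanishes for all `k > n`. -/
def InjDimLE (A : Type u) [Ring A] (Y : Type u) [AddCommGroup Y] [Module A Y] (n : ℕ) : Prop :=
  ∀ k : ℕ, n < k → ∀ X : ModuleCat.{u} A, ExtZero A k X Y

/-- The injective dimension of `Y`, as an element of `ℕ∞` (`⊤` if infinite). -/
noncomputable def injDim (A : Type u) [Ring A] (Y : Type u) [AddCommGroup Y] [Module A Y] : ℕ∞ :=
  sInf ((fun n : ℕ => (n : ℕ∞)) '' {n : ℕ | InjDimLE A Y n})

/-- `X ∈ add Q`: `X` is a direct summand of a finite direct sum of copies of `Q`. -/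
def InAdd (A : Type u) [Ring A] (Q : Type u) [AddCommGroup Q] [Module A Q]
    (X : Type u) [AddCommGroup X] [Module A X] : Prop :=
  ∃ (n : ℕ) (Y : ModuleCat.{u} A), Nonempty ((X × Y) ≃ₗ[A] (Fin n → Q))

/-- `f : M → I` is an injective hull: `I` is an injective module and `f` is an essential
monomorphism. -/
def IsInjHull (A : Type u) [Ring A] {M I : Type u} [AddCommGroup M] [Module A M]
    [AddCommGroup I] [Module A I] (f : M →ₗ[A] I) : Prop :=
  Module.Injective A I ∧ Function.Injective f ∧
    ∀ N : Submodule A I, N ≠ ⊥ → N ⊓ LinearMap.range f ≠ ⊥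

/-- An `A`-module is indecomposable: nonzero, and any direct sum decomposition has a
trivial factor. -/
def Indecomp (A : Type u) [Ring A] (X : Type u) [AddCommGroup X] [Module A X] : Prop :=
  ¬ Subsingleton X ∧
    ∀ Y Z : ModuleCat.{u} A, Nonempty (X ≃ₗ[A] (Y × Z)) → Subsingleton Y ∨ Subsingleton Z


open CategoryTheory Limits

lemma extZero_iff (A : Type u) [Ring A] (X Y : ModuleCat.{u} A) (k : ℕ) :
    ExtZero A (k+1) X Y ↔ Subsingleton (Abelian.Ext X Y (k+1)) := by
  obtain ⟨R⟩ := HasProjectiveResolution.out (Z := X)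
  have h1 : ExtZero A (k+1) X Y ↔
      ∀ f : R.complex.X (k+1) ⟶ Y, R.complex.d (k+2) (k+1) ≫ f = 0 →
        ∃ g : R.complex.X k ⟶ Y, R.complex.d (k+1) k ≫ g = f := by
    have e := R.isoExt (R := ℤ) (k+1) Y
    have : ExtZero A (k+1) X Y ↔ IsZero ((R.complex.linearYonedaObj ℤ Y).homology (k+1)) := by
      rw [← e.isZero_iff, ModuleCat.isZero_iff_subsingleton]
      rfl
    rw [this, ← HomologicalComplex.exactAt_iff_isZero_homology,
      HomologicalComplex.exactAt_iff' _ k (k+1) (k+2) (by simp) (by simp),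
      ShortComplex.moduleCat_exact_iff]
    rfl
  rw [h1]
  constructor
  · intro h
    refine ⟨fun a b => ?_⟩
    have key : ∀ a : Abelian.Ext X Y (k+1), a = 0 := by
      intro a
      obtain ⟨f, hf, rfl⟩ := R.extMk_surjective a (k+2) rfl
      rw [R.extMk_eq_zero_iff f (k+2) rfl hf k rfl]
      exact h f hf
    rw [key a, key b]
  · intro h f hf
    rw [← R.extMk_eq_zero_iff f (k+2) rfl hf k rfl]
    exact Subsingleton.elim _ _

lemma projDimLE_iff (A : Type u) [Ring A] (X : ModuleCat.{u} A) (n : ℕ) :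
    ProjDimLE A X n ↔ HasProjectiveDimensionLT X (n+1) := by
  rw [hasProjectiveDimensionLT_iff.{u}]
  constructor
  · intro h i hi Y e
    obtain ⟨k, rfl⟩ : ∃ k, i = k + 1 := ⟨i - 1, by omega⟩
    have := (extZero_iff A X Y k).1 (h (k+1) hi Y)
    exact Subsingleton.elim _ _
  · intro h k hk Y
    obtain ⟨k, rfl⟩ : ∃ j, k = j + 1 := ⟨k - 1, by omega⟩
    refine (extZero_iff A X Y k).2 ⟨fun a b => ?_⟩
    rw [h _ hk a, h _ hk b]

lemma projDim_le_iff (A : Type u) [Ring A] (X : ModuleCat.{u} A) (n : ℕ) :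
    projDim A X ≤ (n : ℕ∞) ↔ HasProjectiveDimensionLT X (n+1) := by
  rw [← projDimLE_iff]
  constructor
  · intro h
    have hne : ((fun n : ℕ => (n : ℕ∞)) '' {n : ℕ | ProjDimLE A X n}).Nonempty := by
      by_contra hne
      rw [Set.not_nonempty_iff_eq_empty] at hne
      unfold projDim at h
      rw [hne, sInf_empty] at h
      exact absurd h (by simp)
    obtain ⟨j, hj, hj2⟩ := csInf_mem hne
    unfold projDim at h
    rw [← hj2] at h
    have h' : (j : ℕ∞) ≤ n := h
    have h : j ≤ n := by exact_mod_cast h'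
    exact fun k hk Y => hj k (by omega) Y
  · intro h
    exact sInf_le ⟨n, h, rfl⟩

lemma projDim_eq_iff (A : Type u) [Ring A] (X : ModuleCat.{u} A) (n : ℕ) :
    projDim A X = (n : ℕ∞) + 1 ↔
      HasProjectiveDimensionLT X (n+2) ∧ ¬ HasProjectiveDimensionLT X (n+1) := by
  rw [← projDim_le_iff, ← projDim_le_iff, not_le, le_antisymm_iff, ENat.add_one_le_iff (by simp)]
  push_cast
  rfl

section ModTheory

variable {A : Type u} [Ring A]

lemma inj_of_retract {I E : Type u} [AddCommGroup I] [Module A I] [AddCommGroup E] [Module A E]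
    (hI : Module.Injective A I) (i : E →ₗ[A] I) (r : I →ₗ[A] E) (h : ∀ x, r (i x) = x) :
    Module.Injective A E := by
  constructor
  intro X Y _ _ _ _ f hf g
  obtain ⟨k, hk⟩ := hI.out f hf (i ∘ₗ g)
  exact ⟨r ∘ₗ k, fun x => by simp [hk, h]⟩

lemma inj_prod {I E : Type u} [AddCommGroup I] [Module A I] [AddCommGroup E] [Module A E]
    (hI : Module.Injective A I) (hE : Module.Injective A E) : Module.Injective A (I × E) := by
  constructor
  intro X Y _ _ _ _ f hf g
  obtain ⟨k, hk⟩ := hI.out f hf (LinearMap.fst A I E ∘ₗ g)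
  obtain ⟨l, hl⟩ := hE.out f hf (LinearMap.snd A I E ∘ₗ g)
  exact ⟨k.prod l, fun x => by ext <;> simp [hk, hl]⟩

/-- A summand of an injective module, internal version. -/
lemma inj_of_isCompl {I : Type u} [AddCommGroup I] [Module A I]
    (hI : Module.Injective A I) {E F : Submodule A I} (h : IsCompl E F) :
    Module.Injective A E :=
  inj_of_retract hI E.subtype (E.projectionOnto F h) (fun x => by simp)

lemma exists_isCompl_of_inj {I : Type u} [AddCommGroup I] [Module A I]
    {E : Submodule A I} (hE : Module.Injective A E) : ∃ F, IsCompl E F := by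
  obtain ⟨r, hr⟩ := hE.out E.subtype E.injective_subtype LinearMap.id
  exact ⟨_, LinearMap.isCompl_of_proj (f := r) hr⟩

/-- Injective modules embedded are summands, external version. -/
lemma exists_prod_of_inj {J I : Type u} [AddCommGroup I] [Module A I] [AddCommGroup J] [Module A J]
    (hJ : Module.Injective A J) (j : J →ₗ[A] I) (hj : Function.Injective j) :
    ∃ C : Submodule A I, Nonempty ((J × C) ≃ₗ[A] I) := by
  obtain ⟨r, hr⟩ := hJ.out j hj LinearMap.id
  have hE : Module.Injective A (LinearMap.range j) :=
    inj_of_retract hJ (r ∘ₗ (LinearMap.range j).subtype) j.rangeRestrict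
      (by rintro ⟨_, x, rfl⟩; ext; simp [hr])
  obtain ⟨F, hF⟩ := exists_isCompl_of_inj hE
  exact ⟨F, ⟨((LinearEquiv.ofInjective j hj).prodCongr (LinearEquiv.refl A F)).trans
    (Submodule.prodEquivOfIsCompl _ _ hF)⟩⟩

/-- maximal essential extensions inside an injective module of finite length -/
lemma exists_hull {I : Type u} [AddCommGroup I] [Module A I] [IsNoetherian A I] [IsArtinian A I]
    (hI : Module.Injective A I) (M : Submodule A I) :
    ∃ E F : Submodule A I, IsCompl E F ∧ M ≤ E ∧ ∀ N ≤ E, N ⊓ M = ⊥ → N = ⊥ := by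
  obtain ⟨E, ⟨hME, F, hEF⟩, hmin⟩ := WellFounded.has_min (r := ((· < ·) : Submodule A I → Submodule A I → Prop))
    wellFounded_lt {E | M ≤ E ∧ ∃ F, IsCompl E F} ⟨⊤, le_top, ⊥, isCompl_top_bot⟩
  refine ⟨E, F, hEF, hME, fun N hNE hNM => ?_⟩
  have hd : Disjoint M N := by rw [disjoint_iff, inf_comm]; exact hNM
  obtain ⟨φ₀, hφ₀⟩ := hI.out (M.subtype.coprod N.subtype)
    (by
      rw [← LinearMap.ker_eq_bot, LinearMap.ker_coprod_of_disjoint_range _ _ (by simpa using hd)]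
      simp)
    (M.subtype ∘ₗ LinearMap.fst A M N)
  let φ : Module.End A I := E.subtype ∘ₗ E.projectionOnto F hEF ∘ₗ φ₀
  have h1 : ∀ x ∈ M, φ x = x := by
    intro x hx
    have := hφ₀ (⟨x, hx⟩, 0)
    simp at this
    simp only [φ, LinearMap.comp_apply, this]
    have := Submodule.projectionOnto_apply_left hEF ⟨x, hME hx⟩
    simp [this]
  have h2 : ∀ x ∈ N, φ x = 0 := by
    intro x hx
    have := hφ₀ (0, ⟨x, hx⟩)
    simp at this
    simp [φ, LinearMap.comp_apply, this]
  obtain ⟨k, hk⟩ := Filter.eventually_atTop.1 φ.eventually_isCompl_ker_pow_range_pow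
  have hk := hk (k+1) (by omega)
  have h3 : M ≤ LinearMap.range (φ ^ (k+1)) := by
    intro x hx
    refine ⟨x, ?_⟩
    generalize k + 1 = n
    induction n with
    | zero => rfl
    | succ n ih => rw [pow_succ, Module.End.mul_apply, h1 x hx, ih]
  have h4 : LinearMap.range (φ ^ (k+1)) ≤ E := by
    rintro _ ⟨x, rfl⟩
    rw [pow_succ', Module.End.mul_apply]
    exact Submodule.coe_mem _
  have h5 : LinearMap.range (φ ^ (k+1)) = E := by
    by_contra hne
    exact hmin _ ⟨h3, _, hk.symm⟩ (lt_of_le_of_ne h4 hne)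
  have h6 : N ≤ LinearMap.ker (φ ^ (k+1)) := by
    intro x hx
    rw [LinearMap.mem_ker, pow_succ, Module.End.mul_apply, h2 x hx, map_zero]
  have h7 := hk.disjoint
  rw [h5] at h7
  exact eq_bot_iff.2 (h7 h6 hNE)

/-- projective covers of simple modules -/
lemma exists_proj_cover [IsNoetherian A A] [IsArtinian A A] (S : Type u) [AddCommGroup S]
    [Module A S] [IsSimpleModule A S] :
    ∃ (P : Submodule A A) (Q : Submodule A A), IsCompl P Q ∧ (∃ π : P →ₗ[A] S, π ≠ 0) ∧
      ∀ (T : Type u) [AddCommGroup T] [Module A T] [IsSimpleModule A T] (h : P →ₗ[A] T), h ≠ 0 →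
        Nonempty (T ≃ₗ[A] S) := by
  have hnt := IsSimpleModule.nontrivial A S
  obtain ⟨s, hs⟩ := exists_ne (0 : S)
  let π₀ : A →ₗ[A] S := LinearMap.toSpanSingleton A S s
  have hπ₀ : ¬ (⊤ : Submodule A A) ≤ LinearMap.ker π₀ := by
    intro h
    have := h (show (1 : A) ∈ _ from trivial)
    simp [π₀, hs] at this
  obtain ⟨P, ⟨hP, Q, hPQ⟩, hmin⟩ := WellFounded.has_min (r := ((· < ·) : Submodule A A → Submodule A A → Prop))
    wellFounded_lt {E | ¬ E ≤ LinearMap.ker π₀ ∧ ∃ F, IsCompl E F} ⟨⊤, hπ₀, ⊥, isCompl_top_bot⟩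
  have hπ : π₀ ∘ₗ P.subtype ≠ 0 := by
    intro h
    apply hP
    intro x hx
    exact LinearMap.congr_fun h ⟨x, hx⟩
  refine ⟨P, Q, hPQ, ⟨π₀ ∘ₗ P.subtype, hπ⟩, ?_⟩
  intro T _ _ _ h hne
  set π := π₀ ∘ₗ P.subtype with hπdef
  have hsurjh := LinearMap.surjective_of_ne_zero hne
  have hsurjπ := LinearMap.surjective_of_ne_zero hπ
  by_cases hc : LinearMap.ker h ≤ LinearMap.ker π
  · have hmax : IsCoatom (LinearMap.ker h) := by
      rw [← isSimpleModule_iff_isCoatom]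
      exact IsSimpleModule.congr (h.quotKerEquivOfSurjective hsurjh)
    have heq : LinearMap.ker π = LinearMap.ker h := by
      rcases hmax.le_iff.1 hc with h' | h'
      · exact absurd (LinearMap.ker_eq_top.1 h') hπ
      · exact h'
    exact ⟨((h.quotKerEquivOfSurjective hsurjh).symm.trans
      (Submodule.quotEquivOfEq _ _ heq.symm)).trans (π.quotKerEquivOfSurjective hsurjπ)⟩
  · exfalso
    let N := LinearMap.ker h
    let σ : N →ₗ[A] S := π ∘ₗ N.subtype
    have hσ : σ ≠ 0 := by
      intro h'
      apply hc
      intro x hx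
      exact LinearMap.congr_fun h' ⟨x, hx⟩
    let p := P.projectionOnto Q hPQ
    obtain ⟨ψ, hψ⟩ := Module.projective_lifting_property σ (π ∘ₗ p)
      (LinearMap.surjective_of_ne_zero hσ)
    let φ : Module.End A A := P.subtype ∘ₗ N.subtype ∘ₗ ψ
    have hφ1 : ∀ x, π₀ (φ x) = π₀ (p x) := fun x => LinearMap.congr_fun hψ x
    have hφP : ∀ x, φ x ∈ P := fun x => Submodule.coe_mem _
    have hφ2 : ∀ n x, π₀ ((φ ^ (n+1)) x) = π₀ (p x) := by
      intro n
      induction n with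
      | zero => intro x; simpa using hφ1 x
      | succ n ih =>
        intro x
        rw [pow_succ, Module.End.mul_apply, ih, ← hφ1 x]
        have := Submodule.projectionOnto_apply_left hPQ ⟨φ x, hφP x⟩
        simp only [p]
        congr 2
    obtain ⟨k, hk⟩ := Filter.eventually_atTop.1 φ.eventually_isCompl_ker_pow_range_pow
    have hk := hk (k+1) (by omega)
    have h4 : ∀ y ∈ LinearMap.range (φ ^ (k+1)), ∃ hy : y ∈ P, (⟨y, hy⟩ : P) ∈ N := by
      rintro _ ⟨x, rfl⟩
      rw [pow_succ', Module.End.mul_apply]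
      exact ⟨hφP _, Submodule.coe_mem (ψ _)⟩
    have h5 : LinearMap.range (φ ^ (k+1)) = P := by
      by_contra hne
      refine hmin (LinearMap.range (φ ^ (k+1))) ⟨?_, _, hk.symm⟩
        (lt_of_le_of_ne (fun y hy => (h4 y hy).1) hne)
      intro hle
      apply hP
      intro x hx
      have := hle ⟨x, rfl⟩
      rw [LinearMap.mem_ker, hφ2] at this
      have h' := Submodule.projectionOnto_apply_left hPQ ⟨x, hx⟩
      simp only [p] at this
      rw [show x = ((⟨x, hx⟩ : P) : A) from rfl] at this
      rw [h'] at this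
      exact this
    apply hne
    ext ⟨x, hx⟩
    obtain ⟨_, hy⟩ := h4 x (h5 ▸ hx)
    exact hy

end ModTheory

section Classes

variable {A : Type u} [Ring A] {V : Type u} [AddCommGroup V]

/-- `X` has a finite resolution of length `< d` by finite projectives, with Euler class `v`. -/
def HC (t : ModuleCat.{u} A → V) : ℕ → ModuleCat.{u} A → V → Prop
  | 0, X, v => Subsingleton X ∧ v = 0
  | d + 1, X, v => ∃ (P : ModuleCat.{u} A) (π : P →ₗ[A] X) (w : V), Module.Finite A P ∧
      Module.Projective A P ∧ Function.Surjective π ∧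
      HC t d (ModuleCat.of A (LinearMap.ker π)) w ∧ v = t P - w

/-- The properties of the additive invariant. -/
structure GoodInv (t : ModuleCat.{u} A → V) : Prop where
  iso : ∀ X Y : ModuleCat.{u} A, (X ≃ₗ[A] Y) → t X = t Y
  prod : ∀ X Y : ModuleCat.{u} A, Module.Finite A X → Module.Finite A Y →
    t (ModuleCat.of A (X × Y)) = t X + t Y

variable {t : ModuleCat.{u} A → V}

lemma GoodInv.zero (ht : GoodInv t) (X : ModuleCat.{u} A) (h : Subsingleton X) : t X = 0 := by
  have h1 := ht.prod X X inferInstance inferInstance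
  have h2 := ht.iso X (ModuleCat.of A (X × X))
    ⟨⟨⟨fun _ => 0, by simp⟩, by simp⟩, fun _ => 0, fun _ => Subsingleton.elim _ _,
      fun _ => Subsingleton.elim _ _⟩
  rw [h1] at h2
  simpa using h2

lemma HC.iso {d : ℕ} {X Y : ModuleCat.{u} A} {v : V} (h : HC t d X v) (e : X ≃ₗ[A] Y) :
    HC t d Y v := by
  cases d with
  | zero => exact ⟨e.symm.toEquiv.subsingleton_congr.2 h.1, h.2⟩
  | succ d =>
    obtain ⟨P, π, w, h1, h2, h3, h4, h5⟩ := h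
    refine ⟨P, e.toLinearMap ∘ₗ π, w, h1, h2, e.surjective.comp h3, ?_, h5⟩
    rw [LinearEquiv.ker_comp]
    exact h4

lemma HC.succ (ht : GoodInv t) {d : ℕ} {X : ModuleCat.{u} A} {v : V} (h : HC t d X v) :
    HC t (d+1) X v := by
  induction d generalizing X v with
  | zero =>
    have := h.1
    refine ⟨X, LinearMap.id, 0, inferInstance, Module.Projective.of_free, Function.surjective_id,
      ⟨?_, rfl⟩, ?_⟩
    · exact inferInstanceAs (Subsingleton (LinearMap.ker (LinearMap.id : X →ₗ[A] X)))
    · rw [ht.zero X h.1, h.2, sub_zero]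
  | succ d ih =>
    obtain ⟨P, π, w, h1, h2, h3, h4, h5⟩ := h
    exact ⟨P, π, w, h1, h2, h3, ih h4, h5⟩

lemma HC.mono (ht : GoodInv t) {d e : ℕ} (hde : d ≤ e) {X : ModuleCat.{u} A} {v : V}
    (h : HC t d X v) : HC t e X v := by
  induction e, hde using Nat.le_induction with
  | base => exact h
  | succ e _ ih => exact ih.succ ht

lemma HC.horseshoe (ht : GoodInv t) {d : ℕ} {X Y Z : ModuleCat.{u} A} {v w : V}
    (a : X →ₗ[A] Y) (b : Y →ₗ[A] Z) (ha : Function.Injective a) (hab : Function.Exact a b)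
    (hb : Function.Surjective b)
    (hX : HC t d X v) (hZ : HC t d Z w) : HC t d Y (v + w) := by
  induction d generalizing X Y Z v w with
  | zero =>
    have h1 := hX.1
    have h2 := hZ.1
    refine ⟨⟨fun x y => ?_⟩, by rw [hX.2, hZ.2, add_zero]⟩
    have key : ∀ x : Y, x = 0 := by
      intro x
      obtain ⟨z, rfl⟩ := (hab x).1 (Subsingleton.elim _ _)
      rw [Subsingleton.elim z 0, map_zero]
    rw [key x, key y]
  | succ d ih =>
    obtain ⟨P, π, v', h1, h2, h3, h4, rfl⟩ := hX
    obtain ⟨Q, ρ, w', k1, k2, k3, k4, rfl⟩ := hZ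
    obtain ⟨q, hq⟩ := Module.projective_lifting_property b ρ hb
    have hq' : ∀ x, b (q x) = ρ x := fun x => LinearMap.congr_fun hq x
    have hba : ∀ x, b (a x) = 0 := fun x => (hab _).2 ⟨x, rfl⟩
    let Φ : (P × Q) →ₗ[A] Y := (a ∘ₗ π).coprod q
    have hΦ : ∀ x y, Φ (x, y) = a (π x) + q y := fun x y => by simp [Φ]
    have hbΦ : ∀ z, b (Φ z) = ρ z.2 := fun z => by
      rw [← Prod.mk.eta (p := z), hΦ, map_add, hba, hq', zero_add]
    refine ⟨ModuleCat.of A (P × Q), Φ, v' + w', inferInstanceAs (Module.Finite A (P × Q)),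
      inferInstanceAs (Module.Projective A (P × Q)), ?_, ?_, ?_⟩
    · intro y
      obtain ⟨z, hz⟩ := k3 (b y)
      obtain ⟨x, hx⟩ := (hab (y - q z)).1 (by rw [map_sub, hq', hz, sub_self])
      obtain ⟨x', rfl⟩ := h3 x
      exact ⟨(x', z), by rw [hΦ, hx]; abel⟩
    · refine ih (X := ModuleCat.of A (LinearMap.ker π)) (Y := ModuleCat.of A (LinearMap.ker Φ))
        (Z := ModuleCat.of A (LinearMap.ker ρ))
        ((LinearMap.inl A P Q).restrict (p := LinearMap.ker π) (q := LinearMap.ker Φ) ?_)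
        ((LinearMap.snd A P Q).restrict (p := LinearMap.ker Φ) (q := LinearMap.ker ρ) ?_)
        ?_ ?_ ?_ h4 k4
      · intro x hx
        rw [LinearMap.mem_ker] at hx ⊢
        simp [hΦ, hx]
      · intro x hx
        rw [LinearMap.mem_ker] at hx ⊢
        have := hbΦ x
        rw [hx, map_zero] at this
        exact this.symm
      · rintro ⟨x, hx⟩ ⟨y, hy⟩ h
        have := congrArg (fun z => (z : P × Q).1) (congrArg Subtype.val h)
        exact Subtype.ext this
      · rintro ⟨⟨x, y⟩, hx⟩
        constructor
        · intro h
          have hy : y = 0 := congrArg Subtype.val h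
          subst hy
          rw [LinearMap.mem_ker, hΦ, map_zero, add_zero] at hx
          exact ⟨⟨x, ha (by rw [hx, map_zero])⟩, rfl⟩
        · rintro ⟨z, hz⟩
          have := congrArg (fun z => (z : P × Q).2) (congrArg Subtype.val hz)
          exact Subtype.ext this.symm
      · rintro ⟨y, hy⟩
        rw [LinearMap.mem_ker] at hy
        obtain ⟨x, hx⟩ := (hab (q y)).1 (by rw [hq', hy])
        obtain ⟨x', rfl⟩ := h3 x
        refine ⟨⟨(-x', y), ?_⟩, rfl⟩
        rw [LinearMap.mem_ker, hΦ, map_neg, map_neg, hx, neg_add_cancel]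
    · rw [ht.prod P Q h1 k1]; abel

/-- `X` has an Euler class. -/
def HasC (t : ModuleCat.{u} A → V) (X : ModuleCat.{u} A) (v : V) : Prop := ∃ d, HC t d X v

lemma HasC.iso {X Y : ModuleCat.{u} A} {v : V} (h : HasC t X v) (e : X ≃ₗ[A] Y) :
    HasC t Y v := let ⟨d, h⟩ := h; ⟨d, h.iso e⟩

lemma HasC.add (ht : GoodInv t) {X Y Z : ModuleCat.{u} A} {v w : V}
    (a : X →ₗ[A] Y) (b : Y →ₗ[A] Z) (ha : Function.Injective a) (hab : Function.Exact a b)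
    (hb : Function.Surjective b)
    (hX : HasC t X v) (hZ : HasC t Z w) : HasC t Y (v + w) := by
  obtain ⟨d, hX⟩ := hX
  obtain ⟨e, hZ⟩ := hZ
  exact ⟨max d e, HC.horseshoe ht a b ha hab hb (hX.mono ht (le_max_left _ _))
    (hZ.mono ht (le_max_right _ _))⟩

lemma HasC.coker (ht : GoodInv t) {X Y Z : ModuleCat.{u} A} {v w : V}
    (a : X →ₗ[A] Y) (b : Y →ₗ[A] Z) (ha : Function.Injective a) (hab : Function.Exact a b)
    (hb : Function.Surjective b)
    (hX : HasC t X v) (hY : HasC t Y w) : HasC t Z (w - v) := by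
  obtain ⟨d, hY⟩ := hY
  obtain ⟨P, π, w', h1, h2, h3, h4, rfl⟩ := hY.succ ht
  have hker : HasC t (ModuleCat.of A (LinearMap.ker (b ∘ₗ π))) (w' + v) := by
    have e : X ≃ₗ[A] LinearMap.ker b :=
      (LinearEquiv.ofInjective a ha).trans
        (LinearEquiv.ofEq _ _ (LinearMap.exact_iff.1 hab).symm)
    have hX' : HasC t (ModuleCat.of A (LinearMap.ker b)) v := hX.iso e
    refine HasC.add ht (X := ModuleCat.of A (LinearMap.ker π))
      (Y := ModuleCat.of A (LinearMap.ker (b ∘ₗ π))) (Z := ModuleCat.of A (LinearMap.ker b))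
      (Submodule.inclusion (LinearMap.ker_le_ker_comp π b))
      (π.restrict (p := LinearMap.ker (b ∘ₗ π)) (q := LinearMap.ker b) (fun x hx => hx))
      (Submodule.inclusion_injective _) ?_ ?_ ⟨d, h4⟩ hX'
    · rintro ⟨x, hx⟩
      constructor
      · intro h
        exact ⟨⟨x, congrArg Subtype.val h⟩, rfl⟩
      · rintro ⟨⟨z, hz'⟩, hz⟩
        have : z = x := congrArg Subtype.val hz
        subst this
        exact Subtype.ext hz'
    · rintro ⟨y, hy⟩
      obtain ⟨x, rfl⟩ := h3 y
      exact ⟨⟨x, hy⟩, rfl⟩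
  obtain ⟨e, he⟩ := hker
  exact ⟨e+1, P, b ∘ₗ π, w' + v, h1, h2, hb.comp h3, he, by abel⟩

lemma HC.proj [IsNoetherianRing A] (ht : GoodInv t) {d : ℕ} {X : ModuleCat.{u} A} {v : V}
    (h : HC t d X v) (hf : Module.Finite A X) (hp : Module.Projective A X) : v = t X := by
  induction d generalizing X v with
  | zero => rw [h.2, ht.zero X h.1]
  | succ d ih =>
    obtain ⟨P, π, w, h1, h2, h3, h4, rfl⟩ := h
    obtain ⟨s, hs⟩ := Module.projective_lifting_property π LinearMap.id h3
    have hs' : ∀ x, π (s x) = x := fun x => LinearMap.congr_fun hs x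
    let K := LinearMap.ker π
    let e₀ : (K × X) →ₗ[A] P := K.subtype.coprod s
    have he₀ : ∀ k x, e₀ (k, x) = k + s x := fun k x => by simp [e₀]
    have hK0 : ∀ k : K, π k = 0 := fun k => k.2
    have hbij : Function.Bijective e₀ := by
      constructor
      · rw [injective_iff_map_eq_zero]
        rintro ⟨k, x⟩ h
        rw [he₀] at h
        have hx : x = 0 := by
          have := congrArg π h
          rwa [map_add, hK0, hs', zero_add, map_zero] at this
        subst hx
        rw [map_zero, add_zero] at h
        exact Prod.ext (Subtype.ext h) rfl
      · intro p
        refine ⟨(⟨p - s (π p), ?_⟩, π p), ?_⟩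
        · rw [LinearMap.mem_ker, map_sub, hs', sub_self]
        · rw [he₀]; simp
    let e := LinearEquiv.ofBijective e₀ hbij
    have hKf : Module.Finite A K := inferInstance
    have hKp : Module.Projective A K :=
      Module.Projective.of_split (e.toLinearMap ∘ₗ LinearMap.inl A K X)
        (LinearMap.fst A K X ∘ₗ e.symm.toLinearMap) (by ext x; simp)
    have h6 := ih h4 hKf hKp
    have h7 := ht.iso (ModuleCat.of A (K × X)) P e
    have h8 := ht.prod (ModuleCat.of A K) X hKf hf
    rw [← h7, h8, h6]
    abel

lemma HasC.of_proj (X : ModuleCat.{u} A) (hf : Module.Finite A X)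
    (hp : Module.Projective A X) : HasC t X (t X) := by
  refine ⟨1, X, LinearMap.id, 0, hf, hp, Function.surjective_id, ⟨?_, rfl⟩, by simp⟩
  rw [LinearMap.ker_id]
  exact inferInstanceAs (Subsingleton (⊥ : Submodule A X))

lemma HasC.zero [IsNoetherianRing A] (ht : GoodInv t) {X : ModuleCat.{u} A} {v : V}
    (h : HasC t X v) (hX : Subsingleton X) : v = 0 := by
  obtain ⟨d, h⟩ := h
  rw [h.proj ht inferInstance Module.Projective.of_free, ht.zero X hX]

lemma hasC_of_pd [IsNoetherianRing A] (n : ℕ) (X : ModuleCat.{u} A)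
    (hf : Module.Finite A X) (h : HasProjectiveDimensionLT X (n+1)) : ∃ v, HasC t X v := by
  induction n generalizing X with
  | zero =>
    have : Projective X := projective_iff_hasProjectiveDimensionLT_one.2 h
    exact ⟨_, HasC.of_proj X hf ((IsProjective.iff_projective X).2 this)⟩
  | succ n ih =>
    obtain ⟨k, π, hπ⟩ := Module.Finite.exists_fin' A X
    let S : ShortComplex (ModuleCat.{u} A) :=
      ShortComplex.mk (ModuleCat.ofHom (LinearMap.ker π).subtype) (ModuleCat.ofHom π)
        (by ext x; exact x.2)
    have hS : S.ShortExact := by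
      refine ShortComplex.ShortExact.mk' ?_ ?_ ?_
      · rw [ShortComplex.moduleCat_exact_iff]
        intro x hx
        exact ⟨⟨x, hx⟩, rfl⟩
      · rw [ModuleCat.mono_iff_injective]
        exact Subtype.val_injective
      · rw [ModuleCat.epi_iff_surjective]
        exact hπ
    have hP : Projective S.X₂ :=
      (IsProjective.iff_projective (R := A) (Fin k → A)).1 inferInstance
    have h1 : HasProjectiveDimensionLT S.X₁ (n+1) :=
      (hS.hasProjectiveDimensionLT_X₃_iff n hP).1 h
    obtain ⟨w, d, hw⟩ := ih S.X₁ (inferInstanceAs (Module.Finite A (LinearMap.ker π))) h1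
    exact ⟨_, d+1, ModuleCat.of A (Fin k → A), π, w,
      inferInstanceAs (Module.Finite A (Fin k → A)),
      inferInstanceAs (Module.Projective A (Fin k → A)), hπ, hw, rfl⟩

end Classes

section Inv

variable {A : Type u} [Ring A]

/-- intersection of the kernels of all maps `X → S` -/
def relRad (S : Type u) [AddCommGroup S] [Module A S] (X : Type u) [AddCommGroup X] [Module A X] :
    Submodule A X := ⨅ h : X →ₗ[A] S, LinearMap.ker h

lemma mem_relRad {S : Type u} [AddCommGroup S] [Module A S] {X : Type u} [AddCommGroup X]
    [Module A X] {x : X} : x ∈ relRad (A := A) S X ↔ ∀ h : X →ₗ[A] S, h x = 0 := by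
  simp [relRad, Submodule.mem_iInf]

/-- length of the `S`-top of `X` -/
noncomputable def topLen (S : Type u) [AddCommGroup S] [Module A S] (X : ModuleCat.{u} A) : ℕ :=
  (Module.length A (X ⧸ relRad (A := A) S X)).toNat

lemma topLen_iso (S : Type u) [AddCommGroup S] [Module A S] (X Y : ModuleCat.{u} A)
    (e : X ≃ₗ[A] Y) : topLen S X = topLen S Y := by
  unfold topLen
  rw [LinearEquiv.length_eq (Submodule.Quotient.equiv (relRad (A := A) S X)
    (relRad (A := A) S Y) e ?_)]
  ext y
  rw [Submodule.mem_map, mem_relRad]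
  constructor
  · rintro ⟨x, hx, rfl⟩ h
    exact mem_relRad.1 hx (h ∘ₗ e.toLinearMap)
  · intro h
    refine ⟨e.symm y, mem_relRad.2 fun k => h (k ∘ₗ e.symm.toLinearMap), by simp⟩

lemma topLen_prod [IsNoetherianRing A] [IsArtinianRing A]
    (S : Type u) [AddCommGroup S] [Module A S] (X Y : ModuleCat.{u} A)
    (hX : Module.Finite A X) (hY : Module.Finite A Y) :
    topLen S (ModuleCat.of A (X × Y)) = topLen S X + topLen S Y := by
  unfold topLen
  let q : (X × Y) →ₗ[A] (X ⧸ relRad (A := A) S X) × (Y ⧸ relRad (A := A) S Y) :=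
    (Submodule.mkQ _).prodMap (Submodule.mkQ _)
  have hq : Function.Surjective q := by
    rintro ⟨x, y⟩
    obtain ⟨x, rfl⟩ := Submodule.mkQ_surjective _ x
    obtain ⟨y, rfl⟩ := Submodule.mkQ_surjective _ y
    exact ⟨(x, y), rfl⟩
  have hk : relRad (A := A) S (X × Y) = LinearMap.ker q := by
    ext ⟨x, y⟩
    simp only [q, LinearMap.ker_prodMap, Submodule.ker_mkQ, Submodule.mem_prod, mem_relRad]
    constructor
    · intro h
      exact ⟨fun k => by simpa using h (k ∘ₗ LinearMap.fst A X Y),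
        fun k => by simpa using h (k ∘ₗ LinearMap.snd A X Y)⟩
    · rintro ⟨h1, h2⟩ k
      have e1 := h1 (k ∘ₗ LinearMap.inl A X Y)
      have e2 := h2 (k ∘ₗ LinearMap.inr A X Y)
      simp only [LinearMap.comp_apply, LinearMap.inl_apply, LinearMap.inr_apply] at e1 e2
      have : ((x, y) : X × Y) = (x, 0) + (0, y) := by simp
      rw [this, map_add, e1, e2, add_zero]
  have e : ((X × Y) ⧸ relRad (A := A) S (X × Y)) ≃ₗ[A]
      (X ⧸ relRad (A := A) S X) × (Y ⧸ relRad (A := A) S Y) :=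
    (Submodule.quotEquivOfEq _ _ hk).trans (q.quotKerEquivOfSurjective hq)
  have h1 := e.length_eq
  rw [Module.length_prod] at h1
  change (Module.length A ((X × Y) ⧸ relRad (A := A) S (X × Y))).toNat = _
  rw [h1, ENat.toNat_add Module.length_ne_top Module.length_ne_top]

lemma topLen_eq_zero (S : Type u) [AddCommGroup S] [Module A S] (X : ModuleCat.{u} A)
    (h : ∀ k : X →ₗ[A] S, k = 0) : topLen S X = 0 := by
  unfold topLen
  have : relRad (A := A) S X = ⊤ := by
    rw [eq_top_iff]
    intro x _
    exact mem_relRad.2 fun k => by simp [h k]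
  rw [Module.length_eq_zero_iff.2, ENat.toNat_zero]
  rw [Submodule.Quotient.subsingleton_iff]
  exact this

lemma topLen_ne_zero [IsNoetherianRing A] [IsArtinianRing A]
    (S : Type u) [AddCommGroup S] [Module A S] (X : ModuleCat.{u} A)
    (hX : Module.Finite A X) (k : X →ₗ[A] S) (hk : k ≠ 0) : topLen S X ≠ 0 := by
  unfold topLen
  intro h
  rw [ENat.toNat_eq_zero] at h
  rcases h with h | h
  · rw [Module.length_eq_zero_iff, Submodule.Quotient.subsingleton_iff] at h
    apply hk
    ext x
    exact mem_relRad.1 (h ▸ Submodule.mem_top : x ∈ relRad (A := A) S X) k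
  · exact Module.length_ne_top h

lemma finite_simples (M : Type u) [AddCommGroup M] [Module A M] (hM : IsFiniteLength A M) :
    ∃ s : Set (ModuleCat.{u} A), s.Finite ∧ ∀ (S : Type u) [AddCommGroup S] [Module A S]
      [IsSimpleModule A S] (h : M →ₗ[A] S), h ≠ 0 → ∃ T ∈ s, Nonempty (S ≃ₗ[A] T) := by
  induction hM with
  | of_subsingleton =>
    refine ⟨∅, Set.finite_empty, fun S _ _ _ h hne => ?_⟩
    exact absurd (LinearMap.ext fun x => by rw [Subsingleton.elim x 0, map_zero, map_zero]) hne
  | @of_simple_quotient M _ _ N _ _ ih =>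
    obtain ⟨s, hs, hs'⟩ := ih
    refine ⟨insert (ModuleCat.of A (M ⧸ N)) s, hs.insert _, fun S _ _ _ h hne => ?_⟩
    by_cases hN : h ∘ₗ N.subtype = 0
    · refine ⟨_, Set.mem_insert _ _, ?_⟩
      have hle : N ≤ LinearMap.ker h := fun x hx => LinearMap.congr_fun hN ⟨x, hx⟩
      have hne' : N.liftQ h hle ≠ 0 := by
        intro h0
        apply hne
        rw [← N.liftQ_mkQ h hle, h0, LinearMap.zero_comp]
      exact ⟨(LinearEquiv.ofBijective _ (LinearMap.bijective_of_ne_zero hne')).symm⟩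
    · obtain ⟨T, hT, e⟩ := hs' S (h ∘ₗ N.subtype) hN
      exact ⟨T, Set.mem_insert_of_mem _ hT, e⟩

variable (A) in
/-- isomorphism of simple quotients of `A` -/
def simpSetoid : Setoid {I : Submodule A A // IsCoatom I} where
  r I J := Nonempty ((A ⧸ I.1) ≃ₗ[A] (A ⧸ J.1))
  iseqv := ⟨fun _ => ⟨LinearEquiv.refl _ _⟩, fun ⟨e⟩ => ⟨e.symm⟩, fun ⟨e⟩ ⟨f⟩ => ⟨e.trans f⟩⟩

variable (A) in
/-- isomorphism classes of simple modules -/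
def SimpIdx : Type u := Quotient (simpSetoid A)

/-- representative -/
noncomputable def simpRep (i : SimpIdx A) : {I : Submodule A A // IsCoatom I} := Quotient.out i

/-- representative -/
abbrev SimpMod (i : SimpIdx A) : Type u := A ⧸ (simpRep i).1

instance (i : SimpIdx A) : IsSimpleModule A (SimpMod i) :=
  isSimpleModule_iff_isCoatom.2 (simpRep i).2

lemma simpMod_inj (i j : SimpIdx A) (e : SimpMod i ≃ₗ[A] SimpMod j) : i = j := by
  have : (simpSetoid A).r (simpRep i) (simpRep j) := ⟨e⟩
  have := Quotient.sound (s := simpSetoid A) this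
  exact (Quotient.out_eq i).symm.trans (this.trans (Quotient.out_eq j))

lemma exists_simpMod (S : Type u) [AddCommGroup S] [Module A S] [IsSimpleModule A S] :
    ∃ i : SimpIdx A, Nonempty (S ≃ₗ[A] SimpMod i) := by
  obtain ⟨I, hI, ⟨e⟩⟩ := (isSimpleModule_iff_quot_maximal (R := A) (M := S)).1 inferInstance
  have hI' : IsCoatom (I : Submodule A A) := hI.out
  let I' : {I : Submodule A A // IsCoatom I} := ⟨I, hI'⟩
  have : (simpSetoid A).r (simpRep (Quotient.mk (simpSetoid A) I')) I' :=
    Quotient.exact (s := simpSetoid A) (Quotient.out_eq (Quotient.mk (simpSetoid A) I'))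
  obtain ⟨e'⟩ := this
  exact ⟨_, ⟨e.trans e'.symm⟩⟩

lemma simpIdx_finite [IsNoetherianRing A] [IsArtinianRing A] : Finite (SimpIdx A) := by
  obtain ⟨s, hs, h⟩ := finite_simples (A := A) A
    (isFiniteLength_iff_isNoetherian_isArtinian.2 ⟨inferInstance, inferInstance⟩)
  have key : ∀ i : SimpIdx A, ∃ T ∈ s, Nonempty (SimpMod i ≃ₗ[A] T) := by
    intro i
    refine h (SimpMod i) (Submodule.mkQ _) ?_
    intro h0
    apply (simpRep i).2.1
    rw [← Submodule.ker_mkQ (simpRep i).1, h0, LinearMap.ker_zero]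
  choose T hT e using key
  have := hs.to_subtype
  refine Finite.of_injective (β := s) (fun i => ⟨T i, hT i⟩) ?_
  intro i j hij
  have hij : T i = T j := congrArg Subtype.val hij
  obtain ⟨e1⟩ := e i
  obtain ⟨e2⟩ := e j
  rw [hij] at e1
  exact simpMod_inj i j (e1.trans e2.symm)

variable (A) in
/-- the vector of top multiplicities -/
noncomputable def tvec (X : ModuleCat.{u} A) : SimpIdx A → ℚ := fun i => (topLen (SimpMod i) X : ℚ)

lemma tvec_good [IsNoetherianRing A] [IsArtinianRing A] : GoodInv (tvec A) where
  iso X Y e := by funext i; simp only [tvec]; rw [topLen_iso _ X Y e]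
  prod X Y hX hY := by
    funext i; simp only [tvec, Pi.add_apply]; rw [topLen_prod _ X Y hX hY]; push_cast; rfl

end Inv

section Fin

lemma finite_of_essential (R₀ : Type u) [CommRing R₀] [IsNoetherianRing R₀]
    (A : Type u) [Ring A] [Algebra R₀ A] [Module.Finite R₀ A] [IsArtinianRing A]
    [IsNoetherianRing A] (M E : Type u)
    [AddCommGroup M] [Module A M] [AddCommGroup E] [Module A E] (f : M →ₗ[A] E)
    (hM : Module.Finite A M)
    (hess : ∀ N : Submodule A E, N ≠ ⊥ → N ⊓ LinearMap.range f ≠ ⊥) : Module.Finite A E := by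
  let R := LinearMap.range f
  let _ : Module R₀ E := Module.compHom E (algebraMap R₀ A)
  have : IsScalarTower R₀ A E := IsScalarTower.of_algebraMap_smul fun _ _ => rfl
  have hR : Module.Finite A R := inferInstance
  have hR0 : Module.Finite R₀ R := Module.Finite.trans A R
  have key : ∀ (X : Type u) [AddCommGroup X] [Module A X], IsFiniteLength A X →
      IsNoetherian R₀ (X →ₗ[A] E) := by
    intro X _ _ hX
    induction hX with
    | @of_subsingleton X _ _ _ =>
      have : Subsingleton (X →ₗ[A] E) := ⟨fun a b => LinearMap.ext fun x => by
        rw [Subsingleton.elim x 0, map_zero, map_zero]⟩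
      infer_instance
    | @of_simple_quotient X _ _ N hs _ ih =>
      have hQ : IsNoetherian R₀ ((X ⧸ N) →ₗ[A] E) := by
        let _ : Module R₀ (X ⧸ N) := Module.compHom (X ⧸ N) (algebraMap R₀ A)
        have : IsScalarTower R₀ A (X ⧸ N) := IsScalarTower.of_algebraMap_smul fun _ _ => rfl
        have : Module.Finite R₀ (X ⧸ N) := Module.Finite.trans A (X ⧸ N)
        have hmem : ∀ (h : (X ⧸ N) →ₗ[A] E) x, h x ∈ R := by
          intro h
          by_cases h0 : h = 0
          · intro x; simp [h0]
          · have h1 : LinearMap.range h ⊓ R ≠ ⊥ :=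
              hess _ (fun h' => h0 (LinearMap.range_eq_bot.1 h'))
            have h2 : R.comap h = ⊤ := by
              refine (eq_bot_or_eq_top (R.comap h)).resolve_left fun hb => h1 ?_
              rw [eq_bot_iff]
              rintro _ ⟨⟨x, rfl⟩, hx⟩
              have : x ∈ R.comap h := hx
              rw [hb, Submodule.mem_bot] at this
              simp [this]
            intro x
            exact (h2 ▸ Submodule.mem_top : x ∈ R.comap h)
        let Ψ : ((X ⧸ N) →ₗ[A] E) →ₗ[R₀] ((X ⧸ N) →ₗ[R₀] R) :=
          { toFun := fun h => (h.codRestrict R (hmem h)).restrictScalars R₀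
            map_add' := fun _ _ => rfl
            map_smul' := fun _ _ => rfl }
        refine isNoetherian_of_injective Ψ ?_
        intro a b hab
        ext x
        exact congrArg Subtype.val (LinearMap.congr_fun hab (Submodule.Quotient.mk x))
      let α : ((X ⧸ N) →ₗ[A] E) →ₗ[R₀] (X →ₗ[A] E) :=
        { toFun := fun h => h ∘ₗ N.mkQ
          map_add' := fun _ _ => rfl
          map_smul' := fun _ _ => rfl }
      let β : (X →ₗ[A] E) →ₗ[R₀] (N →ₗ[A] E) :=
        { toFun := fun h => h ∘ₗ N.subtype
          map_add' := fun _ _ => rfl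
          map_smul' := fun _ _ => rfl }
      refine isNoetherian_of_range_eq_ker α β ?_
      ext h
      constructor
      · rintro ⟨k, rfl⟩
        ext x
        have : N.mkQ (x : X) = 0 := by simp
        change k (N.mkQ (x : X)) = 0
        rw [this, map_zero]
      · intro hh
        have hle : N ≤ LinearMap.ker h := fun x hx => LinearMap.congr_fun hh ⟨x, hx⟩
        exact ⟨N.liftQ h hle, N.liftQ_mkQ h hle⟩
  have hA := key A (isFiniteLength_iff_isNoetherian_isArtinian.2 ⟨inferInstance, inferInstance⟩)
  let ev : (A →ₗ[A] E) →ₗ[R₀] E :=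
    { toFun := fun h => h 1
      map_add' := fun _ _ => rfl
      map_smul' := fun _ _ => rfl }
  have hev : Function.Surjective ev := fun x => ⟨LinearMap.toSpanSingleton A E x, by simp [ev]⟩
  have : Module.Finite R₀ E := Module.Finite.of_surjective ev hev
  exact Module.Finite.of_restrictScalars_finite R₀ A E

end Fin

section Main

variable {A : Type u} [Ring A]

/-- no simple module from `Bad` embeds in `E` -/
def NoBad (Bad : Set (SimpIdx A)) (E : ModuleCat.{u} A) : Prop :=
  ∀ i ∈ Bad, ∀ h : SimpMod i →ₗ[A] E, h = 0

lemma NoBad.of_inj {Bad : Set (SimpIdx A)} {E F : ModuleCat.{u} A} (h : NoBad Bad E)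
    (j : F →ₗ[A] E) (hj : Function.Injective j) : NoBad Bad F := by
  intro i hi k
  refine LinearMap.ext fun x => hj ?_
  have := LinearMap.congr_fun (h i hi (j ∘ₗ k)) x
  simpa using this

/-- `M` has a finite coresolution by finite injectives avoiding `Bad` in the socle. -/
def Rz (Bad : Set (SimpIdx A)) : ℕ → ModuleCat.{u} A → Prop
  | 0, M => Subsingleton M
  | k + 1, M => ∃ (E L : ModuleCat.{u} A) (a : M →ₗ[A] E) (b : E →ₗ[A] L), Module.Finite A E ∧
      Module.Injective A E ∧ NoBad Bad E ∧ Function.Injective a ∧ Function.Exact a b ∧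
      Function.Surjective b ∧ Rz Bad k L

lemma Rz.summand [IsNoetherianRing A] [IsArtinianRing A] {Bad : Set (SimpIdx A)} {k : ℕ}
    {M X Y : ModuleCat.{u} A} (e : (X × Y) ≃ₗ[A] M) (h : Rz Bad k M) : Rz Bad k X := by
  induction k generalizing M X Y with
  | zero =>
    have : Subsingleton M := h
    refine ⟨fun x y => ?_⟩
    have := e.injective (Subsingleton.elim (e (x, 0)) (e (y, 0)))
    exact congrArg Prod.fst this
  | succ k ih =>
    obtain ⟨E, L, a, b, hEf, hEi, hEb, ha, hab, hb, hL⟩ := h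
    let a₁ : X →ₗ[A] E := a ∘ₗ e.toLinearMap ∘ₗ LinearMap.inl A X Y
    let a₂ : Y →ₗ[A] E := a ∘ₗ e.toLinearMap ∘ₗ LinearMap.inr A X Y
    have ha₁₂ : ∀ x y, a (e (x, y)) = a₁ x + a₂ y := by
      intro x y
      simp only [a₁, a₂, LinearMap.comp_apply, ← map_add]
      simp
    have ha₁ : Function.Injective a₁ := by
      intro x y h
      have := e.injective (ha h)
      exact congrArg Prod.fst this
    let M₁ := LinearMap.range a₁
    let M₂ := LinearMap.range a₂
    have hd : M₁ ⊓ M₂ = ⊥ := by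
      rw [eq_bot_iff]
      rintro _ ⟨⟨x, rfl⟩, ⟨y, hy⟩⟩
      have := e.injective (ha hy)
      have : x = 0 := (congrArg Prod.fst this).symm
      simp [this]
    obtain ⟨E₁, F₁, hEF, hME, hess⟩ := exists_hull hEi M₁
    have hE₁ := inj_of_isCompl hEi hEF
    have hd' : E₁ ⊓ M₂ = ⊥ := by
      apply hess _ inf_le_left
      rw [eq_bot_iff, ← hd]
      exact le_inf inf_le_right (inf_le_left.trans inf_le_right)
    obtain ⟨p, hp⟩ := hE₁.out (E₁.subtype.coprod M₂.subtype)
      (by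
        rw [← LinearMap.ker_eq_bot, LinearMap.ker_coprod_of_disjoint_range _ _
          (by simpa [disjoint_iff] using hd')]
        simp)
      (LinearMap.fst A E₁ M₂)
    have hp1 : ∀ x : E₁, p x = x := fun x => by simpa using hp (x, 0)
    have hp2 : ∀ x ∈ M₂, p x = 0 := fun x hx => by simpa using hp (0, ⟨x, hx⟩)
    let F := LinearMap.ker p
    let pF : E →ₗ[A] F := (LinearMap.id - E₁.subtype ∘ₗ p).codRestrict F (fun x => by
      simp [F, hp1])
    have hpF : ∀ x, (pF x : E) = x - p x := fun x => rfl
    let a₁' : X →ₗ[A] E₁ := a₁.codRestrict E₁ (fun x => hME ⟨x, rfl⟩)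
    let N₂ : Submodule A F := M₂.comap F.subtype
    let θ : E →ₗ[A] (E₁ ⧸ LinearMap.range a₁') × (F ⧸ N₂) :=
      ((LinearMap.range a₁').mkQ ∘ₗ p).prod (N₂.mkQ ∘ₗ pF)
    have hθ : Function.Surjective θ := by
      rintro ⟨x, y⟩
      obtain ⟨x, rfl⟩ := Submodule.mkQ_surjective _ x
      obtain ⟨⟨y, hy⟩, rfl⟩ := Submodule.mkQ_surjective _ y
      have hy : p y = 0 := hy
      refine ⟨x + y, ?_⟩
      have h1 : p (x + y) = x := by rw [map_add, hp1, hy, add_zero]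
      have h2 : pF (x + y) = ⟨y, hy⟩ := by
        apply Subtype.ext; rw [hpF, h1]; simp
      change ((LinearMap.range a₁').mkQ (p (x + y)), N₂.mkQ (pF (x + y))) = _
      rw [h1, h2]
    have hker : LinearMap.ker θ = LinearMap.ker b := by
      ext x
      have h1 : x ∈ LinearMap.ker θ ↔ p x ∈ LinearMap.range a₁' ∧ x - p x ∈ M₂ := by
        rw [LinearMap.mem_ker, Prod.ext_iff]
        change ((LinearMap.range a₁').mkQ (p x) = 0 ∧ N₂.mkQ (pF x) = 0) ↔ _
        rw [Submodule.mkQ_apply, Submodule.mkQ_apply, Submodule.Quotient.mk_eq_zero,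
          Submodule.Quotient.mk_eq_zero]
        rfl
      rw [h1, LinearMap.mem_ker, hab x]
      constructor
      · rintro ⟨⟨x', hx'⟩, ⟨y, hy⟩⟩
        refine ⟨e (x', y), ?_⟩
        have : a₁ x' = p x := congrArg Subtype.val hx'
        rw [ha₁₂, this, hy]; abel
      · rintro ⟨z, rfl⟩
        obtain ⟨⟨x', y⟩, rfl⟩ := e.surjective z
        have h2 : p (a (e (x', y))) = a₁' x' := by
          rw [ha₁₂, map_add, hp2 _ ⟨y, rfl⟩, add_zero]
          exact hp1 (a₁' x')
        rw [h2]
        refine ⟨⟨x', rfl⟩, ⟨y, ?_⟩⟩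
        rw [ha₁₂]
        change _ = a₁ x' + a₂ y - a₁ x'
        abel
    have eL : ((E₁ ⧸ LinearMap.range a₁') × (F ⧸ N₂)) ≃ₗ[A] L :=
      ((θ.quotKerEquivOfSurjective hθ).symm.trans (Submodule.quotEquivOfEq _ _ hker)).trans
        (b.quotKerEquivOfSurjective hb)
    have hL₁ := ih (X := ModuleCat.of A (E₁ ⧸ LinearMap.range a₁'))
      (Y := ModuleCat.of A (F ⧸ N₂)) eL hL
    refine ⟨ModuleCat.of A E₁, ModuleCat.of A (E₁ ⧸ LinearMap.range a₁'), a₁',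
      (LinearMap.range a₁').mkQ, inferInstanceAs (Module.Finite A E₁), hE₁,
      hEb.of_inj (F := ModuleCat.of A E₁) E₁.subtype E₁.injective_subtype, ?_, ?_,
      Submodule.mkQ_surjective _, hL₁⟩
    · intro x y h
      exact ha₁ (congrArg Subtype.val h)
    · intro x
      simp

lemma extend_inj {S H E : Type u} [AddCommGroup S] [Module A S] [AddCommGroup H] [Module A H]
    [AddCommGroup E] [Module A E] (hE : Module.Injective A E) (s : S →ₗ[A] H)
    (hs : Function.Injective s) (hess : ∀ N : Submodule A H, N ≠ ⊥ → N ⊓ LinearMap.range s ≠ ⊥)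
    (j : S →ₗ[A] E) (hj : Function.Injective j) : ∃ k : H →ₗ[A] E, Function.Injective k := by
  obtain ⟨k, hk⟩ := hE.out s hs j
  refine ⟨k, ?_⟩
  rw [← LinearMap.ker_eq_bot]
  by_contra hne
  apply hess _ hne
  rw [eq_bot_iff]
  rintro _ ⟨hx, ⟨x, rfl⟩⟩
  have : j x = 0 := by rw [← hk]; exact hx
  have : x = 0 := hj (by rw [this, map_zero])
  simp [this]

lemma class_of_inj [IsNoetherianRing A] [IsArtinianRing A] {V : Type u} [AddCommGroup V]
    [Module ℚ V] {t : ModuleCat.{u} A → V} (ht : GoodInv t)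
    (Bad : Set (SimpIdx A)) (W : Submodule ℚ V)
    (hgood : ∀ i ∉ Bad, ∃ H : ModuleCat.{u} A, Module.Finite A H ∧ Module.Injective A H ∧
      ∃ s : SimpMod i →ₗ[A] H, Function.Injective s ∧
        (∀ N : Submodule A H, N ≠ ⊥ → N ⊓ LinearMap.range s ≠ ⊥) ∧ ∃ v ∈ W, HasC t H v)
    (n : ℕ) (E : ModuleCat.{u} A) (hEf : Module.Finite A E) (hEi : Module.Injective A E)
    (hEb : NoBad Bad E) (hn : Module.length A E ≤ n) : ∃ v ∈ W, HasC t E v := by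
  induction n generalizing E with
  | zero =>
    have : Subsingleton E := by
      rw [← Module.length_eq_zero_iff (R := A)]
      simpa using hn
    exact ⟨0, W.zero_mem, 0, this, rfl⟩
  | succ n ih =>
    rcases subsingleton_or_nontrivial E with hE | hE
    · exact ⟨0, W.zero_mem, 0, hE, rfl⟩
    obtain ⟨S, hS⟩ := IsAtomic.exists_atom (Submodule A E)
    have hSs : IsSimpleModule A S := isSimpleModule_iff_isAtom.2 hS
    obtain ⟨i, ⟨e⟩⟩ := exists_simpMod (A := A) S
    let j : SimpMod i →ₗ[A] E := S.subtype ∘ₗ e.symm.toLinearMap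
    have hj : Function.Injective j := S.injective_subtype.comp e.symm.injective
    have hi : i ∉ Bad := by
      intro hi
      have h0 := hEb i hi j
      have hnt := IsSimpleModule.nontrivial A (SimpMod i)
      obtain ⟨x, hx⟩ := exists_ne (0 : SimpMod i)
      exact hx (hj (by rw [h0]; simp))
    obtain ⟨H, hHf, hHi, s, hs, hess, v, hv, hvC⟩ := hgood i hi
    obtain ⟨k, hk⟩ := extend_inj hEi s hs hess j hj
    obtain ⟨C, ⟨eC⟩⟩ := exists_prod_of_inj hHi k hk
    have hCi : Module.Injective A C :=
      inj_of_retract hEi (eC.toLinearMap ∘ₗ LinearMap.inr A H C)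
        (LinearMap.snd A H C ∘ₗ eC.symm.toLinearMap) (by intro x; simp)
    have hlen : Module.length A C ≤ n := by
      have h1 := eC.length_eq
      rw [Module.length_prod] at h1
      have h2 : 1 ≤ Module.length A H := by
        rw [Order.one_le_iff_ne_zero, Ne, Module.length_eq_zero_iff]
        intro hsub
        have hnt := IsSimpleModule.nontrivial A (SimpMod i)
        obtain ⟨x, hx⟩ := exists_ne (0 : SimpMod i)
        exact hx (hs (Subsingleton.elim _ _))
      have h3 : Module.length A C + 1 ≤ n + 1 := by
        calc Module.length A C + 1 ≤ Module.length A H + Module.length A C := by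
              rw [add_comm]; gcongr
          _ = Module.length A E := h1
          _ ≤ _ := by simpa using hn
      exact (ENat.add_le_add_iff_right (by simp)).1 h3
    obtain ⟨w, hw, hwC⟩ := ih (ModuleCat.of A C) (inferInstanceAs (Module.Finite A C)) hCi
      (hEb.of_inj (F := ModuleCat.of A C) C.subtype C.injective_subtype) hlen
    refine ⟨v + w, W.add_mem hv hw, ?_⟩
    refine HasC.add ht (X := H) (Y := E) (Z := ModuleCat.of A C)
      (eC.toLinearMap ∘ₗ LinearMap.inl A H C)
      (LinearMap.snd A H C ∘ₗ eC.symm.toLinearMap) ?_ ?_ ?_ hvC hwC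
    · intro x y h
      exact congrArg Prod.fst (eC.injective h)
    · intro x
      obtain ⟨⟨x, c⟩, rfl⟩ := eC.surjective x
      constructor
      · intro h
        have : c = 0 := by simpa using h
        exact ⟨x, by simp [this]⟩
      · rintro ⟨y, hy⟩
        have := eC.injective hy
        have : c = 0 := (congrArg Prod.snd this).symm
        simp [this]
    · intro c
      exact ⟨eC (0, c), by simp⟩

lemma class_mem [IsNoetherianRing A] {V : Type u} [AddCommGroup V]
    [Module ℚ V] {t : ModuleCat.{u} A → V} (ht : GoodInv t)
    (Bad : Set (SimpIdx A)) (W : Submodule ℚ V)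
    (hW : ∀ E : ModuleCat.{u} A, Module.Finite A E → Module.Injective A E → NoBad Bad E →
      ∃ v ∈ W, HasC t E v) (k : ℕ) (M : ModuleCat.{u} A) (hM : Rz Bad k M) (v : V)
    (hv : HasC t M v) : v ∈ W := by
  induction k generalizing M v with
  | zero => rw [hv.zero ht hM]; exact W.zero_mem
  | succ k ih =>
    obtain ⟨E, L, a, b, hEf, hEi, hEb, ha, hab, hb, hL⟩ := hM
    obtain ⟨w, hw, hwC⟩ := hW E hEf hEi hEb
    have := ih L hL _ (HasC.coker ht a b ha hab hb hv hwC)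
    have h2 := W.sub_mem hw this
    simpa using h2

lemma bad_empty [IsNoetherianRing A] [IsArtinianRing A] {κ : Type} (T : κ → ModuleCat.{u} A)
    (hTf : ∀ k, Module.Finite A (T k)) (hTi : ∀ k, Module.Injective A (T k))
    (hTp : ∀ k, ∃ n, HasProjectiveDimensionLT (T k) (n+1))
    (N : ℕ) (hA : Rz {i | ∀ k, ∀ h : SimpMod i →ₗ[A] T k, h = 0} N (ModuleCat.of A A))
    (i : SimpIdx A) : ∃ k, ∃ h : SimpMod i →ₗ[A] T k, h ≠ 0 := by
  classical
  set Bad : Set (SimpIdx A) := {i | ∀ k, ∀ h : SimpMod i →ₗ[A] T k, h = 0} with hBad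
  have key : ∀ i : {i // i ∉ Bad}, ∃ v : SimpIdx A → ℚ, ∃ H : ModuleCat.{u} A,
      Module.Finite A H ∧ Module.Injective A H ∧
      ∃ s : SimpMod i.1 →ₗ[A] H, Function.Injective s ∧
        (∀ N : Submodule A H, N ≠ ⊥ → N ⊓ LinearMap.range s ≠ ⊥) ∧ HasC (tvec A) H v := by
    rintro ⟨i, hi⟩
    have hi : ∃ k, ∃ h : SimpMod i →ₗ[A] T k, h ≠ 0 := by
      by_contra hcon
      push Not at hcon
      exact hi hcon
    obtain ⟨k, h, hh⟩ := hi
    have hinj := LinearMap.injective_of_ne_zero hh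
    obtain ⟨E, F, hEF, hhE, hess⟩ := exists_hull (hTi k) (LinearMap.range h)
    obtain ⟨n, hn⟩ := hTp k
    let r : Retract (ModuleCat.of A E) (T k) :=
      { i := ModuleCat.ofHom E.subtype
        r := ModuleCat.ofHom (E.projectionOnto F hEF)
        retract := by ext x; simp }
    have hpd := r.hasProjectiveDimensionLT (n+1)
    obtain ⟨v, hv⟩ := hasC_of_pd (t := tvec A) n (ModuleCat.of A E)
      (inferInstanceAs (Module.Finite A E)) hpd
    refine ⟨v, ModuleCat.of A E, inferInstanceAs (Module.Finite A E), inj_of_isCompl (hTi k) hEF,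
      h.codRestrict E (fun x => hhE ⟨x, rfl⟩), ?_, ?_, hv⟩
    · intro x y hxy
      exact hinj (congrArg Subtype.val hxy)
    · intro (N : Submodule A E) hN hN'
      apply hN
      have h1 : N.map E.subtype ⊓ LinearMap.range h = ⊥ := by
        rw [eq_bot_iff]
        rintro _ ⟨⟨y, hy, rfl⟩, ⟨x, hx⟩⟩
        have : y ∈ N ⊓ LinearMap.range (h.codRestrict E (fun x => hhE ⟨x, rfl⟩)) :=
          ⟨hy, ⟨x, Subtype.ext hx⟩⟩
        have hN'' : N ⊓ LinearMap.range (h.codRestrict E (fun x => hhE ⟨x, rfl⟩)) = ⊥ := hN'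
        rw [hN'', Submodule.mem_bot] at this
        simp [this]
      have h2 := hess _ (Submodule.map_subtype_le E N) h1
      rw [eq_bot_iff]
      intro y hy
      have h3 : E.subtype y ∈ N.map E.subtype := ⟨y, hy, rfl⟩
      rw [h2, Submodule.mem_bot] at h3
      exact E.injective_subtype (by rw [h3, map_zero])
  choose χ hχ using key
  let W : Submodule ℚ (SimpIdx A → ℚ) := Submodule.span ℚ (Set.range χ)
  have hgood := class_of_inj (tvec_good (A := A)) Bad W (fun i hi => by
    obtain ⟨H, h1, h2, s, h3, h4, h5⟩ := hχ ⟨i, hi⟩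
    exact ⟨H, h1, h2, s, h3, h4, _, Submodule.subset_span ⟨_, rfl⟩, h5⟩)
  have hgood' : ∀ E : ModuleCat.{u} A, Module.Finite A E → Module.Injective A E → NoBad Bad E →
      ∃ v ∈ W, HasC (tvec A) E v := by
    intro E h1 h2 h3
    refine hgood (Module.length A E).toNat E h1 h2 h3 ?_
    rw [ENat.natCast_toNat Module.length_ne_top]
  have hfin := simpIdx_finite (A := A)
  have hsingle : ∀ i : SimpIdx A, Pi.single i (1 : ℚ) ∈ W := by
    intro i
    obtain ⟨P, Q, hPQ, ⟨π, hπ⟩, hcov⟩ := exists_proj_cover (A := A) (SimpMod i)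
    have hPf : Module.Finite A P := inferInstance
    have hPp : Module.Projective A P :=
      Module.Projective.of_split P.subtype (P.projectionOnto Q hPQ) (by ext x; simp)
    have hR := hA.summand (X := ModuleCat.of A P) (Y := ModuleCat.of A Q)
      (Submodule.prodEquivOfIsCompl P Q hPQ)
    have hmem := class_mem (tvec_good (A := A)) Bad W hgood' N (ModuleCat.of A P) hR _
      (HasC.of_proj (ModuleCat.of A P) hPf hPp)
    have h1 : tvec A (ModuleCat.of A P) i ≠ 0 := by
      simp only [tvec]
      exact_mod_cast topLen_ne_zero (SimpMod i) (ModuleCat.of A P) hPf π hπ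
    have h2 : ∀ j, j ≠ i → tvec A (ModuleCat.of A P) j = 0 := by
      intro j hj
      simp only [tvec]
      have := topLen_eq_zero (SimpMod j) (ModuleCat.of A P) (fun k => by
        by_contra hk
        obtain ⟨e⟩ := hcov (SimpMod j) k hk
        exact hj (simpMod_inj _ _ e))
      exact_mod_cast this
    have h3 : Pi.single i (1 : ℚ) = (tvec A (ModuleCat.of A P) i)⁻¹ • tvec A (ModuleCat.of A P) := by
      funext j
      by_cases hj : j = i
      · subst hj; simp [h1]
      · simp [hj, h2 j hj]
    rw [h3]
    exact W.smul_mem _ hmem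
  have := Fintype.ofFinite (SimpIdx A)
  have hWtop : W = ⊤ := by
    rw [eq_top_iff]
    intro x _
    rw [← Finset.univ_sum_single x]
    refine W.sum_mem fun i _ => ?_
    have : (Pi.single i (x i) : SimpIdx A → ℚ) = x i • Pi.single i (1 : ℚ) := by
      rw [← Pi.single_smul]; simp
    rw [this]
    exact W.smul_mem _ (hsingle i)
  have hcard : Fintype.card (SimpIdx A) ≤ Fintype.card {i // i ∉ Bad} := by
    have h1 := finrank_range_le_card (R := ℚ) χ
    have h2 : Set.finrank ℚ (Set.range χ) = Fintype.card (SimpIdx A) := by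
      change Module.finrank ℚ W = _
      rw [hWtop, finrank_top, Module.finrank_fintype_fun_eq_card]
    rw [← h2]
    exact h1
  by_contra hcon
  push Not at hcon
  have hi : i ∈ Bad := hcon
  have := Fintype.card_subtype_lt (p := fun i => i ∉ Bad) (x := i) (by simpa using hi)
  omega

end Main

section Final

variable {A : Type u} [Ring A]

/-- A short exact sequence in `ModuleCat` from linear maps. -/
lemma shortExact_of {X Y Z : ModuleCat.{u} A} (f : X →ₗ[A] Y) (g : Y →ₗ[A] Z)
    (hf : Function.Injective f) (hfg : Function.Exact f g) (hg : Function.Surjective g) :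
    ∃ w, (ShortComplex.mk (ModuleCat.ofHom f) (ModuleCat.ofHom g) w).ShortExact := by
  refine ⟨by ext x; exact hfg.apply_apply_eq_zero x, ShortComplex.ShortExact.mk' ?_ ?_ ?_⟩
  · rw [ShortComplex.moduleCat_exact_iff]
    intro x hx
    exact (hfg x).1 hx
  · rw [ModuleCat.mono_iff_injective]
    exact hf
  · rw [ModuleCat.epi_iff_surjective]
    exact hg

lemma ext_shift {J X Y Z : ModuleCat.{u} A} (hY : Module.Injective A Y)
    (f : X →ₗ[A] Y) (g : Y →ₗ[A] Z)
    (hf : Function.Injective f) (hfg : Function.Exact f g) (hg : Function.Surjective g) (j : ℕ)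
    (h : Subsingleton (Abelian.Ext J X (j + 2))) : Subsingleton (Abelian.Ext J Z (j + 1)) := by
  obtain ⟨w, hS⟩ := shortExact_of f g hf hfg hg
  have hY' : Injective Y := Module.injective_object_of_injective_module A Y
  refine subsingleton_of_forall_eq 0 fun x => ?_
  obtain ⟨y, hy⟩ := Abelian.Ext.covariant_sequence_exact₃ J hS x (n₁ := j + 2) (by omega)
    (Subsingleton.elim (α := Abelian.Ext J X (j + 2)) _ _)
  have hy0 : y = 0 := Abelian.Ext.eq_zero_of_injective (I := Y) y
  rw [← hy, hy0]
  simp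

lemma ext_lift {J X Y Z : ModuleCat.{u} A}
    (f : X →ₗ[A] Y) (g : Y →ₗ[A] Z)
    (hf : Function.Injective f) (hfg : Function.Exact f g) (hg : Function.Surjective g)
    (h : Subsingleton (Abelian.Ext J X 1)) (t : J →ₗ[A] Z) :
    ∃ s : J →ₗ[A] Y, ∀ x, g (s x) = t x := by
  obtain ⟨w, hS⟩ := shortExact_of f g hf hfg hg
  obtain ⟨y, hy⟩ := Abelian.Ext.covariant_sequence_exact₃ J hS
    (Abelian.Ext.mk₀ (ModuleCat.ofHom t)) (n₁ := 1) (by omega)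
    (Subsingleton.elim (α := Abelian.Ext J X 1) _ _)
  obtain ⟨s, rfl⟩ := (Abelian.Ext.mk₀_bijective J Y).2 y
  have h1 : Abelian.Ext.mk₀ (s ≫ ModuleCat.ofHom g) = Abelian.Ext.mk₀ (ModuleCat.ofHom t) := by
    rw [← Abelian.Ext.mk₀_comp_mk₀]
    exact hy
  have h2 := (Abelian.Ext.mk₀_bijective J Z).1 h1
  refine ⟨s.hom, fun x => ?_⟩
  exact LinearMap.congr_fun (congrArg ModuleCat.Hom.hom h2) x

/-- A finite indecomposable injective is the injective hull of any of its simple submodules. -/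
lemma indec_embed [IsNoetherianRing A] [IsArtinianRing A] {κ : Type} (T : κ → ModuleCat.{u} A)
    (hTi : ∀ k, Module.Injective A (T k))
    (hT : ∀ i : SimpIdx A, ∃ k, ∃ h : SimpMod i →ₗ[A] T k, h ≠ 0)
    (J : ModuleCat.{u} A) (hJf : Module.Finite A J) (hJi : Module.Injective A J)
    (hJ : Indecomp A J) : ∃ k, ∃ j : J →ₗ[A] T k, Function.Injective j := by
  have hnt : Nontrivial J := not_subsingleton_iff_nontrivial.1 hJ.1
  obtain ⟨S, hS⟩ := IsAtomic.exists_atom (Submodule A J)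
  have hSs : IsSimpleModule A S := isSimpleModule_iff_isAtom.2 hS
  obtain ⟨i, ⟨e⟩⟩ := exists_simpMod (A := A) S
  obtain ⟨k, h, hh⟩ := hT i
  have hinj := LinearMap.injective_of_ne_zero hh
  obtain ⟨E, F, hEF, hSE, hess⟩ := exists_hull hJi S
  have hEtop : E = ⊤ := by
    rcases hJ.2 (ModuleCat.of A E) (ModuleCat.of A F)
      ⟨(Submodule.prodEquivOfIsCompl E F hEF).symm⟩ with h1 | h1
    · exfalso
      have h1 : Subsingleton E := h1
      rw [Submodule.subsingleton_iff_eq_bot] at h1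
      rw [h1, le_bot_iff] at hSE
      exact hS.1 hSE
    · have h1 : Subsingleton F := h1
      rw [Submodule.subsingleton_iff_eq_bot] at h1
      have := hEF.sup_eq_top
      rwa [h1, sup_bot_eq] at this
  obtain ⟨j, hj⟩ := extend_inj (hTi k) S.subtype S.injective_subtype
    (fun N hN hN' => hN (hess N (by rw [hEtop]; exact le_top) (by simpa using hN')))
    (h ∘ₗ e.toLinearMap) (hinj.comp e.injective)
  exact ⟨k, j, hj⟩

lemma pd_of_prod {J C I : ModuleCat.{u} A} (e : (J × C) ≃ₗ[A] I) (n : ℕ)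
    (h : HasProjectiveDimensionLT I n) : HasProjectiveDimensionLT J n := by
  let r : Retract J I :=
    { i := ModuleCat.ofHom (e.toLinearMap ∘ₗ LinearMap.inl A J C)
      r := ModuleCat.ofHom (LinearMap.fst A J C ∘ₗ e.symm.toLinearMap)
      retract := by ext x; simp }
  exact r.hasProjectiveDimensionLT n

end Final

/-- Let `A` be an artin algebra with `id A = m + 1`, `m ≥ 1`, whose minimal
injective coresolution `0 → A → I⁰ → ⋯ → I^{m+1} → 0` has `I⁰, …, I^m` of projective
dimension at most one. Then every (finitely generated) indecomposable injective `A`-module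
`J` has `pd J ≤ 1` or `pd J = m + 1`; and `J` is a direct summand of `I^{m+1}` iff
`pd J = m + 1`. -/
theorem stmt13 (R₀ : Type u) [CommRing R₀] [IsArtinianRing R₀]
    (A : Type u) [Ring A] [Algebra R₀ A] [Module.Finite R₀ A]
    (m : ℕ) (hm : 1 ≤ m) (hid : injDim A A = ((m : ℕ∞) + 1))
    (K : Fin (m + 3) → ModuleCat.{u} A) (Is : Fin (m + 2) → ModuleCat.{u} A)
    (f : ∀ i : Fin (m + 2), ↥(K i.castSucc) →ₗ[A] ↥(Is i))
    (g : ∀ i : Fin (m + 2), ↥(Is i) →ₗ[A] ↥(K i.succ))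
    (hK0 : Nonempty (A ≃ₗ[A] K 0)) (hKlast : Subsingleton (K (Fin.last (m + 2))))
    (hhull : ∀ i, IsInjHull A (f i))
    (hepi : ∀ i, Function.Surjective (g i))
    (hexact : ∀ i, Function.Exact (f i) (g i))
    (hpd : ∀ i : Fin (m + 1), projDim A (Is i.castSucc) ≤ (1 : ℕ∞)) :
    ∀ J : ModuleCat.{u} A, Module.Finite A J → Module.Injective A J → Indecomp A J →
      ((projDim A J ≤ (1 : ℕ∞) ∨ projDim A J = ((m : ℕ∞) + 1)) ∧
        ((∃ C : ModuleCat.{u} A, Nonempty ((↥J × ↥C) ≃ₗ[A] ↥(Is (Fin.last (m + 1))))) ↔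
          projDim A J = ((m : ℕ∞) + 1))) := by
  have : IsArtinianRing A := IsArtinianRing.of_finite R₀ A
  have : IsNoetherianRing A := IsNoetherianRing.of_finite R₀ A
  have hIinj : ∀ i, Module.Injective A (Is i) := fun i => (hhull i).1
  have hIfin' : ∀ i, Module.Finite A (K i.castSucc) → Module.Finite A (Is i) := fun i hi =>
    finite_of_essential R₀ A (K i.castSucc) (Is i) (f i) hi (hhull i).2.2
  have hKfin : ∀ i : Fin (m + 3), Module.Finite A (K i) := by
    intro i
    induction i using Fin.induction with
    | zero =>
      obtain ⟨e⟩ := hK0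
      exact Module.Finite.equiv e
    | succ i ih =>
      have := hIfin' i ih
      exact Module.Finite.of_surjective (g i) (hepi i)
  have hIfin : ∀ i, Module.Finite A (Is i) := fun i => hIfin' i (hKfin _)
  have hpd1 : ∀ i : Fin (m + 1), HasProjectiveDimensionLT (Is i.castSucc) 2 := fun i =>
    (projDim_le_iff A (Is i.castSucc) 1).1 (by simpa using hpd i)
  have hpdK : ∀ (i : ℕ) (hi : i < m + 2),
      HasProjectiveDimensionLT (K ⟨i, by omega⟩) (i + 1) := by
    intro i
    induction i with
    | zero =>
      intro hi
      obtain ⟨e⟩ := hK0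
      have : Module.Projective A (K 0) := Module.Projective.of_equiv e
      have hP : Projective (K 0) := (IsProjective.iff_projective (R := A) (K 0)).1 this
      exact (projective_iff_hasProjectiveDimensionLT_one (X := K 0)).1 hP
    | succ i ih =>
      intro hi
      have h1 := ih (by omega)
      have h2 : HasProjectiveDimensionLT (Is ⟨i, by omega⟩) (i + 2) := by
        have hi' : i < m + 1 := by omega
        have := hpd1 ⟨i, hi'⟩
        exact hasProjectiveDimensionLT_of_ge (Is (Fin.castSucc ⟨i, hi'⟩)) 2 (i + 2) (by omega)
      obtain ⟨w, hS⟩ := shortExact_of _ _ (hhull ⟨i, by omega⟩).2.1 (hexact ⟨i, by omega⟩)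
        (hepi ⟨i, by omega⟩)
      exact hS.hasProjectiveDimensionLT_X₃ (i + 1) h1 h2
  have hflast : Function.Bijective (f (Fin.last (m + 1))) := by
    refine ⟨(hhull _).2.1, fun y => (hexact _ y).1 ?_⟩
    have : Subsingleton (K (Fin.last (m + 1)).succ) := hKlast
    exact Subsingleton.elim _ _
  let eLast := LinearEquiv.ofBijective _ hflast
  have hpdLast : HasProjectiveDimensionLT (Is (Fin.last (m + 1))) (m + 2) := by
    have h1 : HasProjectiveDimensionLT (K (Fin.last (m + 1)).castSucc) (m + 2) :=
      hpdK (m + 1) (by omega)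
    exact hasProjectiveDimensionLT_of_iso eLast.toModuleIso (m + 2)
  have hRz : ∀ (j i : ℕ) (hi : i + j = m + 2),
      Rz {s | ∀ k, ∀ h : SimpMod s →ₗ[A] Is k, h = 0} j (K ⟨i, by omega⟩) := by
    intro j
    induction j with
    | zero =>
      intro i hi
      obtain rfl : i = m + 2 := by omega
      exact hKlast
    | succ j ih =>
      intro i hi
      have h1 := ih (i + 1) (by omega)
      have hi' : i < m + 2 := by omega
      exact ⟨Is ⟨i, hi'⟩, K ⟨i + 1, by omega⟩, f ⟨i, hi'⟩, g ⟨i, hi'⟩, hIfin _, hIinj _,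
        fun s hs h => hs _ h, (hhull _).2.1, hexact _, hepi _, h1⟩
  have hsimp : ∀ s : SimpIdx A, ∃ k, ∃ h : SimpMod s →ₗ[A] Is k, h ≠ 0 := by
    obtain ⟨e⟩ := hK0
    refine bad_empty Is hIfin hIinj ?_ (m + 2) ?_
    · intro k
      induction k using Fin.lastCases with
      | last => exact ⟨m + 1, hpdLast⟩
      | cast k => exact ⟨1, hpd1 k⟩
    · exact Rz.summand (X := ModuleCat.of A A) (Y := ModuleCat.of A PUnit.{u + 1}) (M := K 0)
        ((LinearEquiv.prodUnique (R := A) (M := A) (M₂ := PUnit.{u + 1})).trans e)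
        (hRz (m + 2) 0 (by omega))
  intro J hJf hJi hJ
  -- the summands of the last term
  have hlast : (∃ C : ModuleCat.{u} A,
      Nonempty ((↥J × ↥C) ≃ₗ[A] ↥(Is (Fin.last (m + 1))))) →
      projDim A J = ((m : ℕ∞) + 1) := by
    rintro ⟨C, ⟨e⟩⟩
    rw [projDim_eq_iff]
    refine ⟨pd_of_prod e _ hpdLast, fun hlt => ?_⟩
    have hext : ∀ (i j : ℕ) (hi : i + j = m),
        Subsingleton (Abelian.Ext J (K ⟨i, by omega⟩) (j + 1)) := by
      intro i
      induction i with
      | zero =>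
        intro j hj
        exact HasProjectiveDimensionLT.subsingleton J (m + 1) (j + 1) (by omega) _
      | succ i ih =>
        intro j hj
        have hi' : i < m + 2 := by omega
        exact ext_shift (hIinj ⟨i, hi'⟩) (f ⟨i, hi'⟩) (g ⟨i, hi'⟩) (hhull _).2.1 (hexact _)
          (hepi _) j (ih (j + 1) (by omega))
    have hm' : m < m + 2 := by omega
    let t : J →ₗ[A] K (Fin.succ ⟨m, hm'⟩) :=
      eLast.symm.toLinearMap ∘ₗ e.toLinearMap ∘ₗ LinearMap.inl A J C
    have ht : Function.Injective t :=
      eLast.symm.injective.comp (e.injective.comp LinearMap.inl_injective)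
    obtain ⟨s, hs⟩ := ext_lift (f ⟨m, hm'⟩) (g ⟨m, hm'⟩) (hhull _).2.1 (hexact _) (hepi _)
      (hext m 0 (by omega)) t
    refine (hhull ⟨m, hm'⟩).2.2 (LinearMap.range s) ?_ ?_
    · intro h0
      apply hJ.1
      refine ⟨fun x y => ht ?_⟩
      rw [LinearMap.range_eq_bot] at h0
      rw [← hs, ← hs, h0]
      simp
    · rw [eq_bot_iff]
      rintro _ ⟨⟨x, rfl⟩, ⟨y, hy⟩⟩
      have h0 : t x = 0 := by
        rw [← hs, ← hy]
        exact (hexact _).apply_apply_eq_zero y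
      have hx : x = 0 := ht (by rw [h0, map_zero])
      simp [hx]
  obtain ⟨k, j, hj⟩ := indec_embed Is hIinj hsimp J hJf hJi hJ
  obtain ⟨C, ⟨e⟩⟩ := exists_prod_of_inj hJi j hj
  have hcase : projDim A J ≤ (1 : ℕ∞) ∨ ∃ C : ModuleCat.{u} A,
      Nonempty ((↥J × ↥C) ≃ₗ[A] ↥(Is (Fin.last (m + 1)))) := by
    induction k using Fin.lastCases with
    | last => exact Or.inr ⟨ModuleCat.of A C, ⟨e⟩⟩
    | cast k =>
      left
      have := (projDim_le_iff A J 1).2 (pd_of_prod (C := ModuleCat.of A C) e 2 (hpd1 k))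
      simpa using this
  refine ⟨hcase.imp id hlast, hlast, fun heq => hcase.resolve_left fun hle => ?_⟩
  rw [heq] at hle
  have : m + 1 ≤ 1 := by exact_mod_cast hle
  omega
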